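/- arXiv:2511.08965 — 10 statements merged into one kernel-verified Lean document; each statement's English description precedes it below -/
import Mathlib

section
/- For every n ≥ 3, the induced saturation number sat*(n, 𝒩), defined as the minimum cardinality of an 𝒩-saturated family of subsets of [n], satisfies (n+6)/4 ≤ sat*(n, 𝒩) ≤ 2n; in particular sat*(n, 𝒩) = Θ(n). -/
variable {n : ℕ}

/-- Two subsets of `[n]` are incomparable if neither contains the other. -/
def Incomp (X Y : Finset (Fin n)) : Prop := ¬ X ⊆ Y ∧ ¬ Y ⊆ X

/-- `A, B, C, D` form an induced copy of the poset `𝒩`, with maximal elements `A, B`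
and minimal elements `C, D`: `C ⊂ A`, `D ⊂ A`, `D ⊂ B`, and the pairs `{A,B}`, `{C,B}`,
`{C,D}` are incomparable.  Here `A` is the maximal element comparable to both minimal
elements and `D` is the minimal element comparable to both maximal elements. -/
def IsNCopy (A B C D : Finset (Fin n)) : Prop :=
  C ⊂ A ∧ D ⊂ A ∧ D ⊂ B ∧ Incomp A B ∧ Incomp C B ∧ Incomp C D

/-- A family contains an induced copy of `𝒩` if four of its members form such a copy. -/
def ContainsN (F : Finset (Finset (Fin n))) : Prop :=
  ∃ A B C D, A ∈ F ∧ B ∈ F ∧ C ∈ F ∧ D ∈ F ∧ IsNCopy A B C D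

/-- `F` is `𝒩`-saturated: it contains no induced copy of `𝒩`, but adding any missing
subset of `[n]` creates one. -/
def NSaturated (F : Finset (Finset (Fin n))) : Prop :=
  ¬ ContainsN F ∧ ∀ S : Finset (Fin n), S ∉ F → ContainsN (insert S F)

def NQ {α : Type*} [PartialOrder α] (A B C D : α) : Prop :=
  C ≤ A ∧ D ≤ A ∧ D ≤ B ∧ ¬ A ≤ B ∧ ¬ B ≤ A ∧ ¬ C ≤ B ∧ ¬ B ≤ C ∧ ¬ C ≤ D ∧ ¬ D ≤ C

theorem NQ_iff {n : ℕ} (A B C D : Finset (Fin n)) : IsNCopy A B C D ↔ NQ A B C D := by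
  unfold IsNCopy NQ Incomp
  constructor
  · rintro ⟨h1, h2, h3, h4, h5, h6⟩
    exact ⟨h1.1, h2.1, h3.1, h4.1, h4.2, h5.1, h5.2, h6.1, h6.2⟩
  · rintro ⟨h1, h2, h3, h4, h4', h5, h5', h6, h6'⟩
    refine ⟨⟨h1, fun h => h6' (h2.trans h)⟩, ⟨h2, fun h => h6 (h1.trans h)⟩,
      ⟨h3, fun h => h4' (h.trans h2)⟩, ⟨h4, h4'⟩, ⟨h5, h5'⟩, ⟨h6, h6'⟩⟩

theorem NQ_dual {α : Type*} [PartialOrder α] (A B C D : α) :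
    NQ A B C D ↔ NQ (α := αᵒᵈ) (OrderDual.toDual D) (OrderDual.toDual C)
      (OrderDual.toDual B) (OrderDual.toDual A) := by
  unfold NQ
  simp only [OrderDual.toDual_le_toDual]
  tauto

theorem key {α : Type*} [PartialOrder α] (F : α → Prop) (X S : α) (hX : F X) (h3 : X ≤ S)
    (h1 : ∀ T, F T → T ≤ S → T ≤ X) (h2 : ∀ T, F T → X ≤ T → S ≤ T ∨ T = X)
    (A B C D : α) (hA : A = S ∨ F A) (hB : B = S ∨ F B) (hC : C = S ∨ F C) (hD : D = S ∨ F D)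
    (hN : NQ A B C D) : ∃ A B C D, F A ∧ F B ∧ F C ∧ F D ∧ NQ A B C D := by
  obtain ⟨n1, n2, n3, n4, n5, n6, n7, n8, n9⟩ := hN
  have r := fun x : α => le_refl x
  have t := fun {x y z : α} (h : x ≤ y) (h' : y ≤ z) => le_trans h h'
  rcases hA with rfl | hA
  · have hB : F B := hB.resolve_left (by rintro rfl; exact n4 (r _))
    have hC : F C := hC.resolve_left (by rintro rfl; exact n9 n2)
    have hD : F D := hD.resolve_left (by rintro rfl; exact n8 n1)
    exact ⟨X, B, C, D, hX, hB, hC, hD, h1 _ hC n1, h1 _ hD n2, n3,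
      fun h => n6 (t (h1 _ hC n1) h), fun h => n5 (t h h3), n6, n7, n8, n9⟩
  rcases hB with rfl | hB
  · have hC : F C := hC.resolve_left (by rintro rfl; exact n6 (r _))
    have hD : F D := hD.resolve_left (by rintro rfl; exact n5 n2)
    have hXA : ¬ X ≤ A := fun h => by
      rcases h2 _ hA h with h | rfl
      · exact n5 h
      · exact n4 h3
    exact ⟨A, X, C, D, hA, hX, hC, hD, n1, n2, h1 _ hD n3,
      fun h => n4 (t h h3), hXA, fun h => n6 (t h h3), fun h => hXA (t h n1), n8, n9⟩
  rcases hC with rfl | hC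
  · have hD : F D := hD.resolve_left (by rintro rfl; exact n8 (r _))
    have hXB : ¬ X ≤ B := fun h => by
      rcases h2 _ hB h with h | rfl
      · exact n6 h
      · exact n7 h3
    exact ⟨A, B, X, D, hA, hB, hX, hD, t h3 n1, n2, n3, n4, n5, hXB,
      fun h => n7 (t h h3), fun h => hXB (t h n3), fun h => n9 (t h h3)⟩
  rcases hD with rfl | hD
  · have hXC : ¬ X ≤ C := fun h => by
      rcases h2 _ hC h with h | rfl
      · exact n9 h
      · exact n8 h3
    exact ⟨A, B, C, X, hA, hB, hC, hX, n1, t h3 n2, t h3 n3, n4, n5, n6, n7,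
      fun h => n8 (t h h3), hXC⟩
  exact ⟨A, B, C, D, hA, hB, hC, hD, n1, n2, n3, n4, n5, n6, n7, n8, n9⟩

theorem key' {α : Type*} [PartialOrder α] (F : α → Prop) (X S : α) (hX : F X) (h3 : S ≤ X)
    (h1 : ∀ T, F T → S ≤ T → X ≤ T) (h2 : ∀ T, F T → T ≤ X → T ≤ S ∨ T = X)
    (A B C D : α) (hA : A = S ∨ F A) (hB : B = S ∨ F B) (hC : C = S ∨ F C) (hD : D = S ∨ F D)
    (hN : NQ A B C D) : ∃ A B C D, F A ∧ F B ∧ F C ∧ F D ∧ NQ A B C D := by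
  obtain ⟨A', B', C', D', a, b, c, d, h⟩ := key (α := αᵒᵈ) F X S hX h3 h1 h2
    D C B A hD hC hB hA ((NQ_dual _ _ _ _).1 hN)
  exact ⟨D', C', B', A', d, c, b, a, (NQ_dual _ _ _ _).2 h⟩

theorem up {n : ℕ} {F : Finset (Finset (Fin n))} (hF : NSaturated F) {X : Finset (Fin n)}
    (hX : X ∈ F) {i : Fin n} (hi : i ∉ X) (hm : ∀ W ∈ F, X ⊆ W → W ≠ X → i ∈ W) :
    ∃ Y ∈ F, i ∈ Y ∧ Y ⊆ insert i X := by
  by_contra hno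
  push Not at hno
  have hS : insert i X ∉ F := fun h => hno _ h (by simp) (by simp)
  obtain ⟨A, B, C, D, hA, hB, hC, hD, h⟩ := hF.2 _ hS
  rw [NQ_iff] at h
  simp only [Finset.mem_insert] at hA hB hC hD
  obtain ⟨A, B, C, D, hA, hB, hC, hD, h⟩ := key (· ∈ F) X (insert i X) hX
    (Finset.subset_insert _ _) (by
      intro T hT hTS x hx
      have := hTS hx
      rcases Finset.mem_insert.1 this with rfl | h
      · exact absurd hTS (hno _ hT hx)
      · exact h)
    (by
      intro T hT hXT
      by_cases hh : T = X
      · exact Or.inr hh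
      · exact Or.inl (Finset.insert_subset (hm T hT hXT hh) hXT)) A B C D hA hB hC hD h
  exact hF.1 ⟨A, B, C, D, hA, hB, hC, hD, (NQ_iff _ _ _ _).2 h⟩

theorem down {n : ℕ} {F : Finset (Finset (Fin n))} (hF : NSaturated F) {Y : Finset (Fin n)}
    (hY : Y ∈ F) {i : Fin n} (hi : i ∈ Y) (hm : ∀ W ∈ F, W ⊆ Y → W ≠ Y → i ∉ W) :
    ∃ X ∈ F, i ∉ X ∧ Y.erase i ⊆ X := by
  by_contra hno
  push Not at hno
  have hS : Y.erase i ∉ F := fun h => hno _ h (by simp) (by simp)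
  obtain ⟨A, B, C, D, hA, hB, hC, hD, h⟩ := hF.2 _ hS
  rw [NQ_iff] at h
  simp only [Finset.mem_insert] at hA hB hC hD
  obtain ⟨A, B, C, D, hA, hB, hC, hD, h⟩ := key' (· ∈ F) Y (Y.erase i) hY
    (Finset.erase_subset _ _) (by
      intro T hT hTS x hx
      by_cases hxi : x = i
      · subst hxi
        by_contra hc
        exact hno _ hT hc hTS
      · exact hTS (Finset.mem_erase.2 ⟨hxi, hx⟩))
    (by
      intro T hT hXT
      by_cases hh : T = Y
      · exact Or.inr hh
      · exact Or.inl (fun x hx => Finset.mem_erase.2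
          ⟨fun h => hm T hT hXT hh (h ▸ hx), hXT hx⟩)) A B C D hA hB hC hD h
  exact hF.1 ⟨A, B, C, D, hA, hB, hC, hD, (NQ_iff _ _ _ _).2 h⟩

theorem empty_mem {n : ℕ} {F : Finset (Finset (Fin n))} (hF : NSaturated F) : ∅ ∈ F := by
  by_contra hS
  obtain ⟨A, B, C, D, hA, hB, hC, hD, h⟩ := hF.2 _ hS
  have h' := h
  rw [NQ_iff] at h
  obtain ⟨n1, n2, n3, n4, n5, n6, n7, n8, n9⟩ := h
  have e : ∀ T : Finset (Fin n), ∅ ≤ T := fun T => Finset.empty_subset T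
  refine hF.1 ⟨A, B, C, D, Finset.mem_of_mem_insert_of_ne hA ?_,
    Finset.mem_of_mem_insert_of_ne hB ?_, Finset.mem_of_mem_insert_of_ne hC ?_,
    Finset.mem_of_mem_insert_of_ne hD ?_, h'⟩ <;> rintro rfl
  exacts [n4 (e _), n5 (e _), n8 (e _), n9 (e _)]

theorem univ_mem {n : ℕ} {F : Finset (Finset (Fin n))} (hF : NSaturated F) :
    Finset.univ ∈ F := by
  by_contra hS
  obtain ⟨A, B, C, D, hA, hB, hC, hD, h⟩ := hF.2 _ hS
  have h' := h
  rw [NQ_iff] at h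
  obtain ⟨n1, n2, n3, n4, n5, n6, n7, n8, n9⟩ := h
  have e : ∀ T : Finset (Fin n), T ≤ Finset.univ := fun T => Finset.subset_univ T
  refine hF.1 ⟨A, B, C, D, Finset.mem_of_mem_insert_of_ne hA ?_,
    Finset.mem_of_mem_insert_of_ne hB ?_, Finset.mem_of_mem_insert_of_ne hC ?_,
    Finset.mem_of_mem_insert_of_ne hD ?_, h'⟩ <;> rintro rfl
  exacts [n5 (e _), n4 (e _), n9 (e _), n8 (e _)]

theorem exists_chain {n : ℕ} (F : Finset (Finset (Fin n))) :
    ∃ K : Finset (Finset (Fin n)), K ⊆ F ∧ (∀ a ∈ K, ∀ b ∈ K, a ⊆ b ∨ b ⊆ a) ∧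
      ∀ W ∈ F, (∀ a ∈ K, a ⊆ W ∨ W ⊆ a) → W ∈ K := by
  classical
  obtain ⟨K, hK, hmax⟩ := Finset.exists_max_image
    (F.powerset.filter (fun K => ∀ a ∈ K, ∀ b ∈ K, a ⊆ b ∨ b ⊆ a)) Finset.card ⟨∅, by simp⟩
  simp only [Finset.mem_filter, Finset.mem_powerset] at hK hmax
  refine ⟨K, hK.1, hK.2, fun W hW h => ?_⟩
  by_contra hc
  have := hmax (insert W K) ⟨Finset.insert_subset hW hK.1, by
    intro a ha b hb
    rcases Finset.mem_insert.1 ha with rfl | ha' <;> rcases Finset.mem_insert.1 hb with rfl | hb'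
    · exact Or.inl subset_rfl
    · exact (h b hb').symm
    · exact h a ha'
    · exact hK.2 a ha' b hb'⟩
  rw [Finset.card_insert_of_notMem hc] at this
  omega

theorem lower {n : ℕ} {F : Finset (Finset (Fin n))} (hF : NSaturated F) :
    n + 2 ≤ 2 * F.card := by
  classical
  obtain ⟨K, hKF, hch, hmax⟩ := exists_chain F
  have he : ∅ ∈ K := hmax _ (empty_mem hF) (fun a _ => Or.inr (Finset.empty_subset a))
  have hu : Finset.univ ∈ K := hmax _ (univ_mem hF) (fun a _ => Or.inl (Finset.subset_univ a))
  have hZ : ∀ i : Fin n, ∃ Z ∈ K, i ∉ Z ∧ ∀ T ∈ K, i ∉ T → T ⊆ Z := by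
    intro i
    obtain ⟨Z, hZ, hm⟩ := Finset.exists_max_image (K.filter (fun T => i ∉ T)) Finset.card
      ⟨∅, by simp [he]⟩
    simp only [Finset.mem_filter] at hZ hm
    refine ⟨Z, hZ.1, hZ.2, fun T hT hiT => ?_⟩
    rcases hch T hT Z hZ.1 with h | h
    · exact h
    · exact (Finset.eq_of_subset_of_card_le h (hm T ⟨hT, hiT⟩)).ge
  have hZ' : ∀ i : Fin n, ∃ Z ∈ K, i ∈ Z ∧ ∀ T ∈ K, i ∈ T → Z ⊆ T := by
    intro i
    obtain ⟨Z, hZ, hm⟩ := Finset.exists_min_image (K.filter (fun T => i ∈ T)) Finset.card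
      ⟨Finset.univ, by simp [hu]⟩
    simp only [Finset.mem_filter] at hZ hm
    refine ⟨Z, hZ.1, hZ.2, fun T hT hiT => ?_⟩
    rcases hch T hT Z hZ.1 with h | h
    · exact (Finset.eq_of_subset_of_card_le h (hm T ⟨hT, hiT⟩)).ge
    · exact h
  choose Z hZK hiZ hZm using hZ
  choose Z' hZK' hiZ' hZm' using hZ'
  have hZZ : ∀ i, Z i ⊆ Z' i := fun i => by
    rcases hch _ (hZK i) _ (hZK' i) with h | h
    · exact h
    · exact absurd (h (hiZ' i)) (hiZ i)
  have hcons : ∀ i, ∀ W ∈ F, Z i ⊆ W → W ⊆ Z' i → W = Z i ∨ W = Z' i := by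
    intro i W hW h1 h2
    have hWK : W ∈ K := hmax W hW (fun a ha => by
      by_cases hia : i ∈ a
      · exact Or.inr (h2.trans (hZm' i a ha hia))
      · exact Or.inl ((hZm i a ha hia).trans h1))
    by_cases hiW : i ∈ W
    · exact Or.inr (h2.antisymm (hZm' i W hWK hiW))
    · exact Or.inl ((hZm i W hWK hiW).antisymm h1)
  have hdi : ∀ i, (∃ Y ∈ F, i ∈ Y ∧ Y ⊆ insert i (Z i)) ∨
      (∃ X ∈ F, i ∉ X ∧ (Z' i).erase i ⊆ X) := by
    intro i
    by_cases hm : ∀ W ∈ F, Z i ⊆ W → W ≠ Z i → i ∈ W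
    · exact Or.inl (up hF (hKF (hZK i)) (hiZ i) hm)
    by_cases hm' : ∀ W ∈ F, W ⊆ Z' i → W ≠ Z' i → i ∉ W
    · exact Or.inr (down hF (hKF (hZK' i)) (hiZ' i) hm')
    exfalso
    push Not at hm hm'
    obtain ⟨W, hW, h1, h2, h3⟩ := hm
    obtain ⟨V, hV, g1, g2, g3⟩ := hm'
    have a1 : ¬ W ⊆ Z' i := fun h => by
      rcases hcons i W hW h1 h with h | h
      · exact h2 h
      · exact h3 (h ▸ hiZ' i)
    have a2 : ¬ Z i ⊆ V := fun h => by
      rcases hcons i V hV h g1 with h | h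
      · exact hiZ i (h ▸ g3)
      · exact g2 h
    exact hF.1 ⟨Z' i, W, V, Z i, hKF (hZK' i), hW, hV, hKF (hZK i), (NQ_iff _ _ _ _).2
      ⟨g1, hZZ i, h1, fun h => h3 (h (hiZ' i)), a1, fun h => h3 (h g3),
        fun h => a1 (h.trans g1), fun h => hiZ i (h g3), a2⟩⟩
  set I := Finset.univ.filter (fun i => ∃ Y ∈ F, i ∈ Y ∧ Y ⊆ insert i (Z i)) with hI
  set J := Finset.univ.filter (fun i => ∃ X ∈ F, i ∉ X ∧ (Z' i).erase i ⊆ X) with hJ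
  have hIJ : n ≤ I.card + J.card := by
    have : (Finset.univ : Finset (Fin n)) ⊆ I ∪ J := fun i _ => by
      simpa [hI, hJ] using hdi i
    have h := (Finset.card_le_card this).trans (Finset.card_union_le _ _)
    simpa using h
  have hIc : I.card ≤ (F.erase ∅).card := by
    have : ∀ i : Fin n, ∃ Y, i ∈ I → Y ∈ F ∧ i ∈ Y ∧ Y ⊆ insert i (Z i) := fun i => by
      by_cases h : i ∈ I
      · obtain ⟨Y, hY⟩ := (Finset.mem_filter.1 h).2
        exact ⟨Y, fun _ => hY⟩
      · exact ⟨∅, fun h' => absurd h' h⟩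
    choose y hy using this
    refine Finset.card_le_card_of_injOn y (fun i hi => ?_) (fun i hi j hj hij => ?_)
    · have := hy i hi
      exact Finset.mem_coe.2 (Finset.mem_erase.2 ⟨Finset.ne_empty_of_mem this.2.1, this.1⟩)
    · by_contra hne
      obtain ⟨_, p1, p2⟩ := hy i hi
      obtain ⟨_, q1, q2⟩ := hy j hj
      have hj' : j ∈ Z i := (Finset.mem_insert.1 (p2 (hij ▸ q1))).resolve_left (Ne.symm hne)
      have hi' : i ∈ Z j := (Finset.mem_insert.1 (q2 (hij ▸ p1))).resolve_left hne
      rcases hch _ (hZK i) _ (hZK j) with h | h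
      · exact hiZ j (h hj')
      · exact hiZ i (h hi')
  have hJc : J.card ≤ (F.erase Finset.univ).card := by
    have : ∀ i : Fin n, ∃ X, i ∈ J → X ∈ F ∧ i ∉ X ∧ (Z' i).erase i ⊆ X := fun i => by
      by_cases h : i ∈ J
      · obtain ⟨Y, hY⟩ := (Finset.mem_filter.1 h).2
        exact ⟨Y, fun _ => hY⟩
      · exact ⟨∅, fun h' => absurd h' h⟩
    choose y hy using this
    refine Finset.card_le_card_of_injOn y (fun i hi => ?_) (fun i hi j hj hij => ?_)
    · have := hy i hi
      exact Finset.mem_coe.2 (Finset.mem_erase.2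
        ⟨fun h => this.2.1 (h ▸ Finset.mem_univ i), this.1⟩)
    · by_contra hne
      obtain ⟨_, p1, p2⟩ := hy i hi
      obtain ⟨_, q1, q2⟩ := hy j hj
      have hj' : j ∉ Z' i := fun h => q1 (hij ▸ p2 (Finset.mem_erase.2 ⟨Ne.symm hne, h⟩))
      have hi' : i ∉ Z' j := fun h => p1 (hij ▸ q2 (Finset.mem_erase.2 ⟨hne, h⟩))
      rcases hch _ (hZK' i) _ (hZK' j) with h | h
      · exact hi' (h (hiZ' i))
      · exact hj' (h (hiZ' j))
  have c1 := Finset.card_erase_add_one (empty_mem hF)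
  have c2 := Finset.card_erase_add_one (univ_mem hF)
  omega

/-- The family of singletons, initial segments. -/
def fam (n : ℕ) : Finset (Finset (Fin n)) :=
  Finset.univ.image (fun i : Fin n => {i}) ∪
    (Finset.univ.filter (fun i : Fin n => 0 < i.val)).image (fun i => Finset.Iic i) ∪ {∅}

theorem mem_fam {n : ℕ} (T : Finset (Fin n)) :
    T ∈ fam n ↔ T = ∅ ∨ (∃ i, T = {i}) ∨ ∃ i : Fin n, T = Finset.Iic i := by
  simp only [fam, Finset.mem_union, Finset.mem_image, Finset.mem_univ, true_and,
    Finset.mem_filter, Finset.mem_singleton]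
  constructor
  · rintro ((⟨i, rfl⟩ | ⟨i, _, rfl⟩) | rfl)
    · exact Or.inr (Or.inl ⟨i, rfl⟩)
    · exact Or.inr (Or.inr ⟨i, rfl⟩)
    · exact Or.inl rfl
  · rintro (rfl | ⟨i, rfl⟩ | ⟨i, rfl⟩)
    · exact Or.inr rfl
    · exact Or.inl (Or.inl ⟨i, rfl⟩)
    · by_cases h : 0 < i.val
      · exact Or.inl (Or.inr ⟨i, h, rfl⟩)
      · refine Or.inl (Or.inl ⟨i, ?_⟩)
        ext x
        simp only [Finset.mem_singleton, Finset.mem_Iic, Fin.le_def, Fin.ext_iff]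
        omega

theorem fam_card {n : ℕ} (hn : 1 ≤ n) : (fam n).card ≤ 2 * n := by
  have h1 : (Finset.univ.filter (fun i : Fin n => 0 < i.val)).card < n := by
    have : (Finset.univ.filter (fun i : Fin n => 0 < i.val)) ⊂ Finset.univ := by
      rw [Finset.filter_ssubset]
      exact ⟨⟨0, hn⟩, by simp⟩
    simpa using Finset.card_lt_card this
  unfold fam
  refine (Finset.card_union_le _ _).trans ?_
  have h2 := Finset.card_union_le (Finset.univ.image (fun i : Fin n => ({i} : Finset (Fin n))))
    ((Finset.univ.filter (fun i : Fin n => 0 < i.val)).image (fun i => Finset.Iic i))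
  have h3 := Finset.card_image_le (s := Finset.univ) (f := fun i : Fin n => ({i} : Finset (Fin n)))
  have h4 := Finset.card_image_le (s := (Finset.univ.filter (fun i : Fin n => 0 < i.val)))
    (f := fun i : Fin n => Finset.Iic i)
  simp only [Finset.card_univ, Fintype.card_fin, Finset.card_singleton] at *
  omega

theorem fam_sat {n : ℕ} : NSaturated (fam n) := by
  classical
  constructor
  · rintro ⟨A, B, C, D, hA, hB, hC, hD, h⟩
    rw [NQ_iff] at h
    obtain ⟨n1, n2, n3, n4, n5, n6, n7, n8, n9⟩ := h
    have big : ∀ T U V : Finset (Fin n), T ∈ fam n → U ≤ T → ¬ T ≤ U → ¬ U ≤ V →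
        ∃ i, T = Finset.Iic i := by
      intro T U V hT h1 h2 h3
      rcases (mem_fam T).1 hT with rfl | ⟨i, rfl⟩ | h
      · exact absurd (Finset.empty_subset _) h2
      · rcases Finset.subset_singleton_iff.1 h1 with rfl | rfl
        · exact absurd (Finset.empty_subset _) h3
        · exact absurd le_rfl h2
      · exact h
    obtain ⟨a, rfl⟩ := big A C D hA n1 (fun h => n9 (n2.trans h)) n8
    obtain ⟨b, rfl⟩ := big B D C hB n3 (fun h => n5 (h.trans n2)) n9
    rcases le_total a b with h | h
    · exact n4 (Finset.Iic_subset_Iic.2 h)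
    · exact n5 (Finset.Iic_subset_Iic.2 h)
  · intro S hS
    rw [mem_fam] at hS
    push Not at hS
    obtain ⟨s1, s2, s3⟩ := hS
    have hne : S.Nonempty := s1
    obtain ⟨M, hM, hMm⟩ : ∃ M ∈ S, ∀ x ∈ S, x ≤ M := ⟨S.max' hne, S.max'_mem hne, S.le_max'⟩
    obtain ⟨s, hs, hsM⟩ : ∃ s ∈ S, s ≠ M := by
      by_contra hc
      push Not at hc
      exact s2 M (Finset.eq_singleton_iff_unique_mem.2 ⟨hM, hc⟩)
    obtain ⟨t, ht, htM⟩ : ∃ t, t ∉ S ∧ t < M := by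
      by_contra hc
      push Not at hc
      refine s3 M (Finset.Subset.antisymm (fun x hx => Finset.mem_Iic.2 (hMm x hx)) ?_)
      intro x hx
      by_contra hxS
      have := hc x hxS
      have h2 := Finset.mem_Iic.1 hx
      exact hxS ((le_antisymm h2 this) ▸ hM)
    have hsM' : s < M := lt_of_le_of_ne (hMm s hs) hsM
    set m : Fin n := max s t with hm
    have hmM : m < M := max_lt hsM' htM
    refine ⟨S, Finset.Iic m, {M}, {s}, Finset.mem_insert_self _ _,
      Finset.mem_insert_of_mem ((mem_fam _).2 (Or.inr (Or.inr ⟨m, rfl⟩))),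
      Finset.mem_insert_of_mem ((mem_fam _).2 (Or.inr (Or.inl ⟨M, rfl⟩))),
      Finset.mem_insert_of_mem ((mem_fam _).2 (Or.inr (Or.inl ⟨s, rfl⟩))), (NQ_iff _ _ _ _).2 ?_⟩
    have hsm : s ∈ Finset.Iic m := Finset.mem_Iic.2 (le_max_left _ _)
    have hMm' : M ∉ Finset.Iic m := fun h => absurd (Finset.mem_Iic.1 h) (not_le.2 hmM)
    refine ⟨Finset.singleton_subset_iff.2 hM, Finset.singleton_subset_iff.2 hs,
      Finset.singleton_subset_iff.2 hsm, fun h => hMm' (h hM),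
      fun h => ht (h (Finset.mem_Iic.2 (le_max_right _ _))),
      fun h => hMm' (h (Finset.mem_singleton_self _)),
      fun h => hsM (Finset.mem_singleton.1 (h hsm)),
      fun h => hsM (Finset.mem_singleton.1 (h (Finset.mem_singleton_self _))).symm,
      fun h => hsM (Finset.mem_singleton.1 (h (Finset.mem_singleton_self _)))⟩

/-- for `n ≥ 3`, the induced saturation number `sat*(n, 𝒩)` (the minimum
cardinality of an `𝒩`-saturated family of subsets of `[n]`) satisfies
`(n+6)/4 ≤ sat*(n,𝒩) ≤ 2n`; in particular it is `Θ(n)`. -/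
theorem stmt1 (n : ℕ) (hn : 3 ≤ n) :
    n + 6 ≤ 4 * sInf {k | ∃ F : Finset (Finset (Fin n)), NSaturated F ∧ F.card = k} ∧
    sInf {k | ∃ F : Finset (Finset (Fin n)), NSaturated F ∧ F.card = k} ≤ 2 * n := by
  have hmem : (fam n).card ∈ {k | ∃ F : Finset (Finset (Fin n)), NSaturated F ∧ F.card = k} :=
    ⟨fam n, fam_sat, rfl⟩
  constructor
  · obtain ⟨F, hF, hc⟩ := Nat.sInf_mem ⟨_, hmem⟩
    rw [← hc]
    have := lower hF
    omega
  · exact (Nat.sInf_le hmem).trans (fam_card (by omega))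
end

section
/- For every n ≥ 3, the family ℱ = {∅} ∪ {{i} : 1 ≤ i ≤ n} ∪ {{1,2,…,i} : 1 ≤ i ≤ n} of subsets of [n] is 𝒩-saturated; in particular its cardinality is 2n. -/
variable {n : ℕ}

/-- for every `n ≥ 3` the family
`ℱ = {∅} ∪ {{i} : 1 ≤ i ≤ n} ∪ {{1,…,i} : 1 ≤ i ≤ n}` is `𝒩`-saturated, and its
cardinality is `2n`.  (Here `[n]` is modelled as `Fin n`, and `{1,…,i}` is `Finset.Iic i`.) -/
theorem stmt2 (n : ℕ) (hn : 3 ≤ n) :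
    NSaturated (({∅} : Finset (Finset (Fin n))) ∪
        Finset.univ.image (fun i : Fin n => ({i} : Finset (Fin n))) ∪
        Finset.univ.image (fun i : Fin n => Finset.Iic i)) ∧
    (({∅} : Finset (Finset (Fin n))) ∪
        Finset.univ.image (fun i : Fin n => ({i} : Finset (Fin n))) ∪
        Finset.univ.image (fun i : Fin n => Finset.Iic i)).card = 2 * n := by 
  have hmem : ∀ S : Finset (Fin n), S ∈ (({∅} : Finset (Finset (Fin n))) ∪
        Finset.univ.image (fun i : Fin n => ({i} : Finset (Fin n))) ∪
        Finset.univ.image (fun i : Fin n => Finset.Iic i)) ↔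
        (S = ∅ ∨ (∃ i, S = {i}) ∨ ∃ i, S = Finset.Iic i) := by
    intro S
    simp only [Finset.mem_union, Finset.mem_singleton, Finset.mem_image, Finset.mem_univ,
      true_and, or_assoc, eq_comm]
  refine ⟨⟨?_, ?_⟩, ?_⟩
  · rintro ⟨A, B, C, D, hA, hB, hC, hD, hCA, hDA, hDB, hAB, hCB, hCD⟩
    rw [hmem] at hA hB
    have hD0 : D ≠ ∅ := by
      rintro rfl
      exact hCD.2 (Finset.empty_subset _)
    rcases hB with rfl | ⟨b, rfl⟩ | ⟨b, rfl⟩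
    · exact hAB.2 (Finset.empty_subset _)
    · exact hD0 (Finset.ssubset_singleton_iff.1 hDB)
    · rcases hA with rfl | ⟨a, rfl⟩ | ⟨a, rfl⟩
      · exact hAB.1 (Finset.empty_subset _)
      · exact hD0 (Finset.ssubset_singleton_iff.1 hDA)
      · rcases le_total a b with h | h
        · exact hAB.1 (Finset.Iic_subset_Iic.2 h)
        · exact hAB.2 (Finset.Iic_subset_Iic.2 h)
  · intro S hS
    rw [hmem] at hS
    push Not at hS
    obtain ⟨h0, h1, h2⟩ := hS
    have hm := S.max'_mem h0
    have hmax : ∀ y ∈ S, y ≤ S.max' h0 := fun y hy => S.le_max' y hy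
    generalize S.max' h0 = m at hm hmax
    obtain ⟨j, hj, hjm⟩ : ∃ j ∈ S, j ≠ m := by
      by_contra! h
      exact h1 m (Finset.eq_singleton_iff_unique_mem.2 ⟨hm, h⟩)
    obtain ⟨x, hx, hxm⟩ : ∃ x, x ∉ S ∧ x ≤ m := by
      by_contra! h
      apply h2 m
      ext y
      rw [Finset.mem_Iic]
      refine ⟨hmax y, fun hy => ?_⟩
      by_contra hc
      exact absurd hy (not_le.2 (h y hc))
    have hjlt : j < m := lt_of_le_of_ne (hmax j hj) hjm
    have hxne : x ≠ m := fun h => hx (h ▸ hm)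
    have hxlt : x < m := lt_of_le_of_ne hxm hxne
    have hxj : x ≠ j := fun h => hx (h ▸ hj)
    have hBx : x ∈ Finset.Iic (max x j) := Finset.mem_Iic.2 (le_max_left _ _)
    have hBj : j ∈ Finset.Iic (max x j) := Finset.mem_Iic.2 (le_max_right _ _)
    have hBm : m ∉ Finset.Iic (max x j) := by
      rw [Finset.mem_Iic, not_le]
      exact max_lt hxlt hjlt
    refine ⟨S, Finset.Iic (max x j), {m}, {j}, Finset.mem_insert_self _ _,
      Finset.mem_insert_of_mem ((hmem _).2 (Or.inr (Or.inr ⟨_, rfl⟩))),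
      Finset.mem_insert_of_mem ((hmem _).2 (Or.inr (Or.inl ⟨_, rfl⟩))),
      Finset.mem_insert_of_mem ((hmem _).2 (Or.inr (Or.inl ⟨_, rfl⟩))), ?_⟩
    refine ⟨⟨Finset.singleton_subset_iff.2 hm, fun h => hjm (Finset.mem_singleton.1 (h hj))⟩,
      ⟨Finset.singleton_subset_iff.2 hj, fun h => hjm (Finset.mem_singleton.1 (h hm)).symm⟩,
      ⟨Finset.singleton_subset_iff.2 hBj, fun h => hxj (Finset.mem_singleton.1 (h hBx))⟩,
      ⟨fun h => hBm (h hm), fun h => hx (h hBx)⟩,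
      ⟨fun h => hBm (Finset.singleton_subset_iff.1 h),
        fun h => hjm (Finset.mem_singleton.1 (h hBj))⟩,
      ⟨fun h => hjm (Finset.mem_singleton.1 (Finset.singleton_subset_iff.1 h)).symm,
        fun h => hjm (Finset.mem_singleton.1 (Finset.singleton_subset_iff.1 h))⟩⟩
  · obtain ⟨k, rfl⟩ : ∃ k, n = k + 1 := ⟨n - 1, by omega⟩
    have hint : Finset.univ.image (fun i : Fin (k+1) => ({i} : Finset (Fin (k+1)))) ∩
        Finset.univ.image (fun i : Fin (k+1) => Finset.Iic i) = {{0}} := by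
      ext S
      simp only [Finset.mem_inter, Finset.mem_image, Finset.mem_univ, true_and,
        Finset.mem_singleton]
      constructor
      · rintro ⟨⟨i, rfl⟩, j, hj⟩
        have : (0 : Fin (k+1)) ∈ Finset.Iic j := Finset.mem_Iic.2 (Fin.zero_le _)
        rw [hj, Finset.mem_singleton] at this
        rw [this]
      · rintro rfl
        refine ⟨⟨0, rfl⟩, 0, ?_⟩
        ext y
        simp
    have hc1 : (Finset.univ.image (fun i : Fin (k+1) => ({i} : Finset (Fin (k+1))))).card
        = k + 1 := by
      rw [Finset.card_image_of_injective _ Finset.singleton_injective]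
      simp
    have hc2 : (Finset.univ.image (fun i : Fin (k+1) => Finset.Iic i)).card = k + 1 := by
      rw [Finset.card_image_of_injective _ (fun a b h => le_antisymm
        (Finset.Iic_subset_Iic.1 (le_of_eq h))
        (Finset.Iic_subset_Iic.1 (le_of_eq h.symm)))]
      simp
    have hu := Finset.card_union_add_card_inter
      (Finset.univ.image (fun i : Fin (k+1) => ({i} : Finset (Fin (k+1)))))
      (Finset.univ.image (fun i : Fin (k+1) => Finset.Iic i))
    rw [hint, hc1, hc2, Finset.card_singleton] at hu
    rw [Finset.union_assoc, ← Finset.insert_eq, Finset.card_insert_of_notMem]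
    · omega
    · simp only [Finset.mem_union, Finset.mem_image, Finset.mem_univ, true_and, not_or,
        not_exists]
      refine ⟨fun i => Finset.singleton_ne_empty i, fun i h => ?_⟩
      have : i ∈ Finset.Iic i := Finset.mem_Iic.2 le_rfl
      rw [h] at this
      simp at this
end

section
/- Let ℱ be an 𝒩-saturated family of subsets of [n], let k ≥ 1 and A₁, …, A_k ∈ ℱ, and suppose ⋂_{i=1}^{k} A_i ∉ ℱ. Then in every induced copy of 𝒩 formed by ⋂_{i=1}^{k} A_i together with three members of ℱ, the set ⋂_{i=1}^{k} A_i is one of the two minimal elements of the copy. -/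
variable {n : ℕ}

/-- if `A₁, …, A_k ∈ F` (`k ≥ 1`) and `⋂ A_i ∉ F`, then in every induced
copy of `𝒩` formed by `⋂ A_i` together with three members of `F`, the set `⋂ A_i` is one
of the two minimal elements. -/
theorem stmt5 (n k : ℕ) (hk : 1 ≤ k) (F : Finset (Finset (Fin n))) (hF : NSaturated F)
    (A : Fin k → Finset (Fin n)) (hA : ∀ i, A i ∈ F)
    (hI : Finset.univ.inf A ∉ F) :
    ∀ A' B' C' D' : Finset (Fin n), IsNCopy A' B' C' D' →
      (A' = Finset.univ.inf A ∨ A' ∈ F) → (B' = Finset.univ.inf A ∨ B' ∈ F) →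
      (C' = Finset.univ.inf A ∨ C' ∈ F) → (D' = Finset.univ.inf A ∨ D' ∈ F) →
      (Finset.univ.inf A = A' ∨ Finset.univ.inf A = B' ∨
        Finset.univ.inf A = C' ∨ Finset.univ.inf A = D') →
      Finset.univ.inf A = C' ∨ Finset.univ.inf A = D' := by 
  intro A' B' C' D' hN hA' hB' hC' hD' hor
  have hle : ∀ i, Finset.univ.inf A ⊆ A i := fun i => Finset.inf_le (Finset.mem_univ i)
  have hex : ∀ X : Finset (Fin n), ¬ X ⊆ Finset.univ.inf A → ∃ i, ¬ X ⊆ A i := by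
    intro X hX
    by_contra hcon
    push Not at hcon
    exact hX (Finset.le_inf fun i _ => hcon i)
  obtain ⟨hCA, hDA, hDB, hAB, hCB, hCD⟩ := hN
  by_contra hne
  rw [not_or] at hne
  have hCF : C' ∈ F := hC'.resolve_left fun h => hne.1 h.symm
  have hDF : D' ∈ F := hD'.resolve_left fun h => hne.2 h.symm
  rcases hor with h | h | h | h
  · have hBF : B' ∈ F := hB'.resolve_left fun h2 => hAB.1 (by rw [h2, h])
    subst h
    obtain ⟨i, hi⟩ := hex B' hAB.2
    exact hF.1 ⟨A i, B', C', D', hA i, hBF, hCF, hDF, hCA.trans_subset (hle i),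
      hDA.trans_subset (hle i), hDB, ⟨fun h => hAB.1 ((hle i).trans h), hi⟩, hCB, hCD⟩
  · have hAF : A' ∈ F := hA'.resolve_left fun h2 => hAB.1 (by rw [h2, h])
    subst h
    obtain ⟨i, hi⟩ := hex C' hCB.1
    exact hF.1 ⟨A', A i, C', D', hAF, hA i, hCF, hDF, hCA, hDA,
      hDB.trans_subset (hle i), ⟨fun h => hi (hCA.subset.trans h),
      fun h => hAB.2 ((hle i).trans h)⟩, ⟨hi, fun h => hCB.2 ((hle i).trans h)⟩, hCD⟩
  · exact hne.1 h
  · exact hne.2 h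
end

section
/- Let ℱ be an 𝒩-saturated family of subsets of [n], let k ≥ 1 and A₁, …, A_k ∈ ℱ, and suppose ⋂_{i=1}^{k} A_i ∉ ℱ. Then there exist X, Y, Z ∈ ℱ such that the four sets X, Y (maximal elements), ⋂_{i=1}^{k} A_i and Z (minimal elements) form an induced copy of 𝒩 in which ⋂_{i=1}^{k} A_i is the minimal element comparable to both maximal elements (i.e. ⋂_{i=1}^{k} A_i ⊂ X, ⋂_{i=1}^{k} A_i ⊂ Y, Z ⊂ X, and the pairs {X,Y}, {Z,Y}, {Z, ⋂ A_i} are incomparable). -/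
variable {n : ℕ}

/-- if `A₁, …, A_k ∈ F` (`k ≥ 1`) and `⋂ A_i ∉ F`, then there are
`X, Y, Z ∈ F` such that `X, Y` (maximal) together with `Z` and `⋂ A_i` (minimal) form an
induced copy of `𝒩` in which `⋂ A_i` is the minimal element comparable to both maximal
elements: `⋂ A_i ⊂ X`, `⋂ A_i ⊂ Y`, `Z ⊂ X`, and the pairs `{X,Y}`, `{Z,Y}`,
`{Z, ⋂ A_i}` are incomparable. -/
theorem stmt6 (n k : ℕ) (hk : 1 ≤ k) (F : Finset (Finset (Fin n))) (hF : NSaturated F)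
    (A : Fin k → Finset (Fin n)) (hA : ∀ i, A i ∈ F)
    (hI : Finset.univ.inf A ∉ F) :
    ∃ X Y Z, X ∈ F ∧ Y ∈ F ∧ Z ∈ F ∧ IsNCopy X Y Z (Finset.univ.inf A) := by 
  classical
  obtain ⟨hN, hS⟩ := hF
  obtain ⟨P, Q, R, T, hP, hQ, hR, hT, h⟩ := hS _ hI
  have hle : ∀ i, Finset.univ.inf A ⊆ A i := fun i => Finset.inf_le (Finset.mem_univ i)
  have hge : ∀ B : Finset (Fin n), (∀ i, B ⊆ A i) → B ⊆ Finset.univ.inf A :=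
    fun B hB => Finset.le_inf fun i _ => hB i
  have hne : ∀ B ∈ F, B ≠ Finset.univ.inf A := fun B hB e => hI (e ▸ hB)
  generalize Finset.univ.inf A = I at *
  obtain ⟨h1, h2, h3, ⟨h4, h4'⟩, ⟨h5, h5'⟩, ⟨h6, h6'⟩⟩ := h
  have nP : P = I ∨ P ∈ F := Finset.mem_insert.1 hP
  have nQ : Q = I ∨ Q ∈ F := Finset.mem_insert.1 hQ
  have nR : R = I ∨ R ∈ F := Finset.mem_insert.1 hR
  have nT : T = I ∨ T ∈ F := Finset.mem_insert.1 hT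
  by_cases eT : T = I
  · subst eT
    refine ⟨P, Q, R, nP.resolve_left h2.ne', nQ.resolve_left h3.ne', nR.resolve_left ?_,
      h1, h2, h3, ⟨h4, h4'⟩, ⟨h5, h5'⟩, ⟨h6, h6'⟩⟩
    rintro rfl
    exact h6 subset_rfl
  have mT := nT.resolve_left eT
  by_cases eP : P = I
  · subst eP
    have mQ : Q ∈ F := nQ.resolve_left (by rintro rfl; exact h4 subset_rfl)
    have mR : R ∈ F := nR.resolve_left h1.ne
    refine absurd (hge Q fun i => ?_) h4'
    by_contra hc
    exact hN ⟨A i, Q, R, T, hA i, mQ, mR, mT, h1.trans_subset (hle i), h2.trans_subset (hle i),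
      h3, ⟨fun h => h4 ((hle i).trans h), hc⟩, ⟨h5, h5'⟩, ⟨h6, h6'⟩⟩
  have mP := nP.resolve_left eP
  by_cases eQ : Q = I
  · subst eQ
    have mR : R ∈ F := nR.resolve_left (by rintro rfl; exact h5 subset_rfl)
    refine absurd (hge R fun i => ?_) h5
    by_contra hc
    exact hN ⟨P, A i, R, T, mP, hA i, mR, mT, h1, h2, h3.trans_subset (hle i),
      ⟨fun h => hc (h1.subset.trans h), fun h => h4' ((hle i).trans h)⟩,
      ⟨hc, fun h => h5' ((hle i).trans h)⟩, ⟨h6, h6'⟩⟩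
  have mQ := nQ.resolve_left eQ
  by_cases eR : R = I
  · subst eR
    have : ∃ i, ¬ T ⊆ A i := by
      by_contra hc
      push Not at hc
      exact h6' (hge T hc)
    obtain ⟨i, hi⟩ := this
    have hPi : ¬ P ⊆ A i := fun h => hi (h2.subset.trans h)
    have hiP : ¬ A i ⊆ P := fun h => hN ⟨P, Q, A i, T, mP, mQ, hA i, mT, ⟨h, hPi⟩, h2, h3,
      ⟨h4, h4'⟩, ⟨fun h => h5 ((hle i).trans h), fun h => hi (h3.subset.trans h)⟩,
      ⟨fun h => h6 ((hle i).trans h), hi⟩⟩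
    exact ⟨P, A i, T, mP, hA i, mT, h2, h1, (hle i).ssubset_of_ne (hne _ (hA i)).symm,
      ⟨hPi, hiP⟩, ⟨hi, fun h => h6 ((hle i).trans h)⟩, ⟨h6', h6⟩⟩
  exact absurd ⟨P, Q, R, T, mP, mQ, nR.resolve_left eR, mT, h1, h2, h3, ⟨h4, h4'⟩, ⟨h5, h5'⟩,
    ⟨h6, h6'⟩⟩ hN
end

section
/- Let ℱ be an 𝒩-saturated family of subsets of [n], let l ≥ 1 and B₁, …, B_l ∈ ℱ, and suppose ⋃_{i=1}^{l} B_i ∉ ℱ. Then in every induced copy of 𝒩 formed by ⋃_{i=1}^{l} B_i together with three members of ℱ, the set ⋃_{i=1}^{l} B_i is one of the two maximal elements of the copy. -/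
variable {n : ℕ}

/-- if `B₁, …, B_l ∈ F` (`l ≥ 1`) and `⋃ B_i ∉ F`, then in every induced
copy of `𝒩` formed by `⋃ B_i` together with three members of `F`, the set `⋃ B_i` is one
of the two maximal elements. -/
theorem stmt7 (n l : ℕ) (hl : 1 ≤ l) (F : Finset (Finset (Fin n))) (hF : NSaturated F)
    (B : Fin l → Finset (Fin n)) (hB : ∀ i, B i ∈ F)
    (hU : Finset.univ.sup B ∉ F) :
    ∀ A' B' C' D' : Finset (Fin n), IsNCopy A' B' C' D' →
      (A' = Finset.univ.sup B ∨ A' ∈ F) → (B' = Finset.univ.sup B ∨ B' ∈ F) →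
      (C' = Finset.univ.sup B ∨ C' ∈ F) → (D' = Finset.univ.sup B ∨ D' ∈ F) →
      (Finset.univ.sup B = A' ∨ Finset.univ.sup B = B' ∨
        Finset.univ.sup B = C' ∨ Finset.univ.sup B = D') →
      Finset.univ.sup B = A' ∨ Finset.univ.sup B = B' := by
  intro A' B' C' D' hN hA hB' hC hD hU'
  have hsub : ∀ i, B i ⊆ Finset.univ.sup B := fun i =>
    Finset.le_sup (f := B) (Finset.mem_univ i)
  have hex : ∀ X : Finset (Fin n), ¬ Finset.univ.sup B ⊆ X → ∃ i, ¬ B i ⊆ X := by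
    intro X hX
    by_contra hcon
    push Not at hcon
    exact hX (Finset.sup_le (fun i _ => hcon i))
  generalize Finset.univ.sup B = U at *
  by_cases h1 : U = A'
  · exact Or.inl h1
  by_cases h2 : U = B'
  · exact Or.inr h2
  exfalso
  have hAF : A' ∈ F := hA.resolve_left (fun h => h1 h.symm)
  have hBF : B' ∈ F := hB'.resolve_left (fun h => h2 h.symm)
  obtain ⟨hCA, hDA, hDB, hAB, hCB, hCD⟩ := hN
  apply hF.1
  rcases hU' with h | h | h | h
  · exact (h1 h).elim
  · exact (h2 h).elim
  · subst h
    have hDF : D' ∈ F := by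
      rcases hD with h | h
      · exact absurd h.le hCD.2
      · exact h
    obtain ⟨i, hi⟩ := hex B' hCB.1
    exact ⟨A', B', B i, D', hAF, hBF, hB i, hDF,
      lt_of_le_of_lt (hsub i) hCA, hDA, hDB, hAB,
      ⟨hi, fun h => hCB.2 (h.trans (hsub i))⟩,
      ⟨fun h => hi (h.trans hDB.1), fun h => hCD.2 (h.trans (hsub i))⟩⟩
  · subst h
    have hCF : C' ∈ F := by
      rcases hC with h | h
      · exact absurd h.le hCD.1
      · exact h
    obtain ⟨i, hi⟩ := hex C' hCD.2
    exact ⟨A', B', C', B i, hAF, hBF, hCF, hB i, hCA,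
      lt_of_le_of_lt (hsub i) hDA, lt_of_le_of_lt (hsub i) hDB, hAB, hCB,
      ⟨fun h => hCD.1 (h.trans (hsub i)), hi⟩⟩
end

section
/- Let ℱ be an 𝒩-saturated family of subsets of [n], let l ≥ 1 and B₁, …, B_l ∈ ℱ, and suppose ⋃_{i=1}^{l} B_i ∉ ℱ. Then there exist X, Y, Z ∈ ℱ such that the four sets ⋃_{i=1}^{l} B_i and X (maximal elements), Y and Z (minimal elements) form an induced copy of 𝒩 in which ⋃_{i=1}^{l} B_i is the maximal element comparable to both minimal elements (i.e. Y ⊂ ⋃ B_i, Z ⊂ ⋃ B_i, Z ⊂ X, and the pairs {⋃ B_i, X}, {Y, X}, {Y, Z} are incomparable). -/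
variable {n : ℕ}

/-- if `B₁, …, B_l ∈ F` (`l ≥ 1`) and `⋃ B_i ∉ F`, then there are
`X, Y, Z ∈ F` such that `⋃ B_i` and `X` (maximal) together with `Y, Z` (minimal) form an
induced copy of `𝒩` in which `⋃ B_i` is the maximal element comparable to both minimal
elements: `Y ⊂ ⋃ B_i`, `Z ⊂ ⋃ B_i`, `Z ⊂ X`, and the pairs `{⋃ B_i, X}`, `{Y, X}`,
`{Y, Z}` are incomparable. -/
theorem stmt8 (n l : ℕ) (hl : 1 ≤ l) (F : Finset (Finset (Fin n))) (hF : NSaturated F)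
    (B : Fin l → Finset (Fin n)) (hB : ∀ i, B i ∈ F)
    (hU : Finset.univ.sup B ∉ F) :
    ∃ X Y Z, X ∈ F ∧ Y ∈ F ∧ Z ∈ F ∧ IsNCopy (Finset.univ.sup B) X Y Z := by 
  obtain ⟨hN, hS⟩ := hF
  have hle : ∀ i, B i ⊆ Finset.univ.sup B := fun i => Finset.le_sup (f := B) (Finset.mem_univ i)
  have hex : ∀ X, ¬ Finset.univ.sup B ⊆ X → ∃ i, ¬ B i ⊆ X := by
    intro X hX
    by_contra! h
    exact hX (Finset.sup_le fun i _ => h i)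
  have hC := hS _ hU
  generalize Finset.univ.sup B = U at *
  have hne : ∀ i, B i ⊂ U := fun i => (hle i).ssubset_of_ne (fun h => hU (h ▸ hB i))
  obtain ⟨P, Q, R, S, hP, hQ, hR, hS', h1, h2, h3, ⟨h4, h4'⟩, ⟨h5, h5'⟩, ⟨h6, h6'⟩⟩ := hC
  rw [Finset.mem_insert] at hP hQ hR hS'
  by_cases eP : P = U
  · subst eP
    have q : Q ≠ P := by rintro rfl; exact h4 subset_rfl
    exact ⟨Q, R, S, hQ.resolve_left q, hR.resolve_left h1.ne, hS'.resolve_left h2.ne,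
      h1, h2, h3, ⟨h4, h4'⟩, ⟨h5, h5'⟩, ⟨h6, h6'⟩⟩
  replace hP := hP.resolve_left eP
  by_cases eQ : Q = U
  · subst eQ
    have r : R ≠ Q := by rintro rfl; exact h5 subset_rfl
    replace hR := hR.resolve_left r
    replace hS' := hS'.resolve_left h3.ne
    obtain ⟨i, hi⟩ := hex P h4'
    have a1 : ¬ B i ⊆ S := fun h => hi (h.trans h2.1)
    by_cases hD : S ⊆ B i
    · exact (hN ⟨P, B i, R, S, hP, hB i, hR, hS', h1, h2, ⟨hD, a1⟩,
        ⟨fun h => h4 (h.trans (hle i)), hi⟩,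
        ⟨fun h => h5 (h.trans (hle i)), fun h => hi (h.trans h1.1)⟩, ⟨h6, h6'⟩⟩).elim
    · exact ⟨P, B i, S, hP, hB i, hS', hne i, h3, h2, ⟨h4', h4⟩,
        ⟨hi, fun h => h4 (h.trans (hle i))⟩, ⟨a1, hD⟩⟩
  replace hQ := hQ.resolve_left eQ
  exfalso
  by_cases eR : R = U
  · subst eR
    have r : S ≠ R := by rintro rfl; exact h6 subset_rfl
    replace hS' := hS'.resolve_left r
    obtain ⟨i, hi⟩ := hex Q h5
    exact hN ⟨P, Q, B i, S, hP, hQ, hB i, hS', (hne i).trans h1, h2, h3, ⟨h4, h4'⟩,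
      ⟨hi, fun h => h5' (h.trans (hle i))⟩,
      ⟨fun h => hi (h.trans h3.1), fun h => h6' (h.trans (hle i))⟩⟩
  replace hR := hR.resolve_left eR
  by_cases eS : S = U
  · subst eS
    obtain ⟨i, hi⟩ := hex R h6'
    exact hN ⟨P, Q, R, B i, hP, hQ, hR, hB i, h1, (hne i).trans h2, (hne i).trans h3, ⟨h4, h4'⟩,
      ⟨h5, h5'⟩, ⟨fun h => h6 (h.trans (hle i)), hi⟩⟩
  exact hN ⟨P, Q, R, S, hP, hQ, hR, hS'.resolve_left eS, h1, h2, h3, ⟨h4, h4'⟩, ⟨h5, h5'⟩,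
    ⟨h6, h6'⟩⟩
end

section
/- Let ℱ be an 𝒩-saturated family of subsets of [n], let k, l ≥ 1, and let A₁, …, A_k ∈ ℱ and B₁, …, B_l ∈ ℱ satisfy B_i ⊆ A_j for all 1 ≤ i ≤ l and 1 ≤ j ≤ k. Then there exists M ∈ ℱ with ⋃_{i=1}^{l} B_i ⊆ M ⊆ ⋂_{j=1}^{k} A_j. -/
variable {n : ℕ}

theorem stmt9 (n k l : ℕ) (hk : 1 ≤ k) (hl : 1 ≤ l)
    (F : Finset (Finset (Fin n))) (hF : NSaturated F)
    (A : Fin k → Finset (Fin n)) (B : Fin l → Finset (Fin n))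
    (hA : ∀ j, A j ∈ F) (hB : ∀ i, B i ∈ F)
    (hBA : ∀ i j, B i ⊆ A j) :
    ∃ M ∈ F, Finset.univ.sup B ⊆ M ∧ M ⊆ Finset.univ.inf A := by
  obtain ⟨hN, hS⟩ := hF
  obtain ⟨S, hSdef⟩ : ∃ S, S = (F.filter (fun X => ∀ i, B i ⊆ X)).inf id := ⟨_, rfl⟩
  have P1 : ∀ X ∈ F, (∀ i, B i ⊆ X) → S ⊆ X := by
    intro X hX h
    rw [hSdef]
    exact Finset.inf_le (f := id) (Finset.mem_filter.2 ⟨hX, h⟩)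
  have P2 : ∀ X, (∀ Y ∈ F, (∀ i, B i ⊆ Y) → X ⊆ Y) → X ⊆ S := by
    intro X h
    rw [hSdef]
    refine Finset.le_inf (f := id) ?_
    intro Y hY
    exact h Y (Finset.mem_filter.1 hY).1 (Finset.mem_filter.1 hY).2
  have P3 : ∀ i, B i ⊆ S := fun i => P2 _ fun Y _ h => h i
  by_cases hSF : S ∈ F
  · exact ⟨S, hSF, Finset.sup_le fun i _ => P3 i,
      Finset.le_inf fun j _ => P1 _ (hA j) fun i => hBA i j⟩
  exfalso
  have Q1 : ∀ X ∈ F, ¬ S ⊆ X → ∃ Y ∈ F, Y ⊆ S ∧ ¬ Y ⊆ X := by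
    intro X hX h
    by_contra! hc
    exact h (P1 X hX fun i => hc _ (hB i) (P3 i))
  have Q2 : ∀ X, ¬ X ⊆ S → ∃ Y ∈ F, S ⊆ Y ∧ ¬ X ⊆ Y := by
    intro X h
    by_contra! hc
    exact h (P2 X fun Y hY h' => hc Y hY (P1 Y hY h'))
  obtain ⟨a, b, c, d, ha, hb, hc, hd, h⟩ := hS S hSF
  have T : ∀ {X Y Z : Finset (Fin n)}, X ⊆ Y → Y ⊆ Z → X ⊆ Z := fun h h' => h.trans h'
  have R : ∀ X : Finset (Fin n), X ⊆ X := fun X => Finset.Subset.refl X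
  simp only [ContainsN, IsNCopy, Incomp, ssubset_iff_subset_not_subset, not_exists] at hN h
  obtain ⟨⟨ca, nac⟩, ⟨da, nad⟩, ⟨db, nbd⟩, ⟨nab, nba⟩, ⟨ncb, nbc⟩, ⟨ncd, ndc⟩⟩ := h
  rw [Finset.mem_insert] at ha hb hc hd
  rcases ha with rfl | ha
  · have hb := hb.resolve_left (by rintro rfl; exact nab (R _))
    have hc := hc.resolve_left (by rintro rfl; exact nac (R _))
    have hd := hd.resolve_left (by rintro rfl; exact nad (R _))
    obtain ⟨Y, hY, h1, h2⟩ := Q2 b nba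
    exact hN Y b c d ⟨hY, hb, hc, hd, ⟨T ca h1, fun h => nac (T h1 h)⟩,
      ⟨T da h1, fun h => nad (T h1 h)⟩, ⟨db, nbd⟩, ⟨fun h => nab (T h1 h), h2⟩,
      ⟨ncb, nbc⟩, ⟨ncd, ndc⟩⟩
  rcases hb with rfl | hb
  · have hc := hc.resolve_left (by rintro rfl; exact nbc (R _))
    have hd := hd.resolve_left (by rintro rfl; exact nbd (R _))
    obtain ⟨Y, hY, h1, h2⟩ := Q2 c ncb
    exact hN a Y c d ⟨ha, hY, hc, hd, ⟨ca, nac⟩, ⟨da, nad⟩,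
      ⟨T db h1, fun h => nbd (T h1 h)⟩, ⟨fun h => h2 (T ca h), fun h => nba (T h1 h)⟩,
      ⟨h2, fun h => nbc (T h1 h)⟩, ⟨ncd, ndc⟩⟩
  rcases hc with rfl | hc
  · have hd := hd.resolve_left (by rintro rfl; exact ncd (R _))
    obtain ⟨Y, hY, h1, h2⟩ := Q1 b hb ncb
    exact hN a b Y d ⟨ha, hb, hY, hd, ⟨T h1 ca, fun h => nac (T h h1)⟩, ⟨da, nad⟩,
      ⟨db, nbd⟩, ⟨nab, nba⟩, ⟨h2, fun h => nbc (T h h1)⟩,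
      ⟨fun h => h2 (T h db), fun h => ndc (T h h1)⟩⟩
  rcases hd with rfl | hd
  · obtain ⟨Y, hY, h1, h2⟩ := Q1 c hc ndc
    exact hN a b c Y ⟨ha, hb, hc, hY, ⟨ca, nac⟩, ⟨T h1 da, fun h => nad (T h h1)⟩,
      ⟨T h1 db, fun h => nbd (T h h1)⟩, ⟨nab, nba⟩, ⟨ncb, nbc⟩,
      ⟨fun h => ncd (T h h1), h2⟩⟩
  exact hN a b c d ⟨ha, hb, hc, hd, ⟨ca, nac⟩, ⟨da, nad⟩, ⟨db, nbd⟩, ⟨nab, nba⟩,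
    ⟨ncb, nbc⟩, ⟨ncd, ndc⟩⟩
end

section
/- Let ℱ be an 𝒩-saturated family of subsets of [n] and let A, B, C, D ∈ ℱ form a butterfly with maximal elements A, B and minimal elements C, D. Then there exists M ∈ ℱ with C ∪ D ⊆ M ⊆ A ∩ B. -/
variable {n : ℕ}

/-- `A, B, C, D` form a butterfly with maximal elements `A, B` and minimal elements
`C, D`: `C ⊂ A`, `C ⊂ B`, `D ⊂ A`, `D ⊂ B`, with `A, B` incomparable and `C, D`
incomparable. -/
def IsButterfly (A B C D : Finset (Fin n)) : Prop :=
  C ⊂ A ∧ C ⊂ B ∧ D ⊂ A ∧ D ⊂ B ∧ Incomp A B ∧ Incomp C D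

theorem aux_N {n : ℕ} {F : Finset (Finset (Fin n))} (h : ¬ ContainsN F)
    {A B C D : Finset (Fin n)} (hA : A ∈ F) (hB : B ∈ F) (hC : C ∈ F) (hD : D ∈ F)
    (h1 : C ⊆ A) (h2 : D ⊆ A) (h3 : D ⊆ B) (h4 : ¬ A ⊆ B) (h5 : ¬ B ⊆ A)
    (h6 : ¬ C ⊆ B) (h7 : ¬ B ⊆ C) (h8 : ¬ C ⊆ D) (h9 : ¬ D ⊆ C) : False := by
  refine h ⟨A, B, C, D, hA, hB, hC, hD, ⟨h1, fun k => h9 (h2.trans k)⟩,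
    ⟨h2, fun k => h8 (h1.trans k)⟩, ⟨h3, fun k => h5 (k.trans h2)⟩, ⟨h4, h5⟩, ⟨h6, h7⟩, ⟨h8, h9⟩⟩

theorem aux_key {n : ℕ} {F : Finset (Finset (Fin n))} (hF : ¬ ContainsN F)
    {A B C D S : Finset (Fin n)} (hA : A ∈ F) (hB : B ∈ F) (hC : C ∈ F) (hD : D ∈ F)
    (hCA : C ⊆ A) (hCB : C ⊆ B) (hDA : D ⊆ A) (hDB : D ⊆ B)
    (hAB : ¬ A ⊆ B) (hBA : ¬ B ⊆ A) (hCD : ¬ C ⊆ D) (hDC : ¬ D ⊆ C)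
    (hM : ∀ M ∈ F, C ⊆ M → D ⊆ M → M ⊆ A → M ⊆ B → False)
    (hCS : C ⊆ S) (hDS : D ⊆ S)
    (hS1 : ∀ Y ∈ F, C ⊆ Y → D ⊆ Y → S ⊆ Y)
    (hS2 : ∀ x, (∀ Y ∈ F, C ⊆ Y → D ⊆ Y → x ⊆ Y) → x ⊆ S)
    {x : Finset (Fin n)} (hx : x ∈ F) (hxS : ¬ x ⊆ S) (hSx : ¬ S ⊆ x) :
    (¬ x ⊆ A ∧ ¬ x ⊆ B) ∧ (¬ C ⊆ x ∧ ¬ D ⊆ x) := by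
  have hxC : ¬ x ⊆ C := fun k => hxS (k.trans hCS)
  have hxD : ¬ x ⊆ D := fun k => hxS (k.trans hDS)
  have hAx : ¬ A ⊆ x := fun k => hSx ((hS1 A hA hCA hDA).trans k)
  have hBx : ¬ B ⊆ x := fun k => hSx ((hS1 B hB hCB hDB).trans k)
  have L : x ⊆ A → x ⊆ B → False := by
    intro xA xB
    refine hxS (hS2 x fun Y hY cY dY => ?_)
    by_contra hxY
    have hE : ∃ E ∈ F, E ⊆ A ∧ E ⊆ B ∧ E ⊆ Y ∧ ¬ E ⊆ x ∧ ¬ x ⊆ E := by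
      by_cases hc : C ⊆ x
      · exact ⟨D, hD, hDA, hDB, dY, fun k => hSx (hS1 x hx hc k), hxD⟩
      · exact ⟨C, hC, hCA, hCB, cY, hc, hxC⟩
    obtain ⟨E, hE, eA, eB, eY, ex, xe⟩ := hE
    have hYx : ¬ Y ⊆ x := fun k => ex (eY.trans k)
    by_cases yA : Y ⊆ A
    · by_cases yB : Y ⊆ B
      · exact hM Y hY cY dY yA yB
      · exact aux_N hF hB hY hx hE xB eB eY (fun k => hxY (xB.trans k)) yB hxY hYx xe ex
    · exact aux_N hF hA hY hx hE xA eA eY (fun k => hxY (xA.trans k)) yA hxY hYx xe ex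
  have hcd : C ⊆ x → D ⊆ x → False := fun c d => hSx (hS1 x hx c d)
  have c1 : ¬ C ⊆ x := by
    intro c
    have d : ¬ D ⊆ x := hcd c
    refine L ?_ ?_
    · by_contra k
      exact aux_N hF hA hx hD hC hDA hCA c hAx k d hxD hDC hCD
    · by_contra k
      exact aux_N hF hB hx hD hC hDB hCB c hBx k d hxD hDC hCD
  have d1 : ¬ D ⊆ x := by
    intro d
    refine L ?_ ?_
    · by_contra k
      exact aux_N hF hA hx hC hD hCA hDA d hAx k c1 hxC hCD hDC
    · by_contra k
      exact aux_N hF hB hx hC hD hCB hDB d hBx k c1 hxC hCD hDC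
  refine ⟨⟨fun k => L k ?_, fun k => L ?_ k⟩, c1, d1⟩
  · by_contra k2
    exact aux_N hF hA hB hx hC k hCA hCB hAB hBA k2 hBx hxC c1
  · by_contra k2
    exact aux_N hF hB hA hx hC k hCB hCA hBA hAB k2 hAx hxC c1

/-- if `A, B, C, D ∈ F` form a butterfly with maximal elements `A, B` and
minimal elements `C, D`, then there exists `M ∈ F` with `C ∪ D ⊆ M ⊆ A ∩ B`. -/
theorem stmt10 (n : ℕ) (F : Finset (Finset (Fin n))) (hF : NSaturated F)
    (A B C D : Finset (Fin n)) (hA : A ∈ F) (hB : B ∈ F) (hC : C ∈ F) (hD : D ∈ F)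
    (hbf : IsButterfly A B C D) :
    ∃ M ∈ F, C ∪ D ⊆ M ∧ M ⊆ A ∩ B := by
  classical
  obtain ⟨hN, hSat⟩ := hF
  obtain ⟨⟨hCA, -⟩, ⟨hCB, -⟩, ⟨hDA, -⟩, ⟨hDB, -⟩, ⟨hAB, hBA⟩, ⟨hCD, hDC⟩⟩ := hbf
  by_contra hno
  have hM : ∀ M ∈ F, C ⊆ M → D ⊆ M → M ⊆ A → M ⊆ B → False := fun M h c d a b =>
    hno ⟨M, h, Finset.union_subset c d, Finset.subset_inter a b⟩
  obtain ⟨S, hCS, hDS, hS1, hS2⟩ : ∃ S : Finset (Fin n), C ⊆ S ∧ D ⊆ S ∧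
      (∀ Y ∈ F, C ⊆ Y → D ⊆ Y → S ⊆ Y) ∧
      (∀ x, (∀ Y ∈ F, C ⊆ Y → D ⊆ Y → x ⊆ Y) → x ⊆ S) := by
    refine ⟨Finset.univ.filter fun i => ∀ Y ∈ F, C ⊆ Y → D ⊆ Y → i ∈ Y, ?_, ?_, ?_, ?_⟩
    · intro i hi
      simp only [Finset.mem_filter, Finset.mem_univ, true_and]
      exact fun Y _ c _ => c hi
    · intro i hi
      simp only [Finset.mem_filter, Finset.mem_univ, true_and]
      exact fun Y _ _ d => d hi
    · intro Y hY c d i hi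
      simp only [Finset.mem_filter, Finset.mem_univ, true_and] at hi
      exact hi Y hY c d
    · intro x h i hi
      simp only [Finset.mem_filter, Finset.mem_univ, true_and]
      exact fun Y hY c d => h Y hY c d hi
  have hSA : S ⊆ A := hS1 A hA hCA hDA
  have hSB : S ⊆ B := hS1 B hB hCB hDB
  have hSF : S ∉ F := fun h => hM S h hCS hDS hSA hSB
  have key : ∀ x ∈ F, ¬ x ⊆ S → ¬ S ⊆ x → (¬ x ⊆ A ∧ ¬ x ⊆ B) ∧ (¬ C ⊆ x ∧ ¬ D ⊆ x) :=
    fun x hx h1 h2 => aux_key hN hA hB hC hD hCA hCB hDA hDB hAB hBA hCD hDC hM hCS hDS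
      hS1 hS2 hx h1 h2
  have up : ∀ x, S ⊆ x → C ⊆ x := fun x h => hCS.trans h
  have dn : ∀ x, x ⊆ S → x ⊆ A := fun x h => h.trans hSA
  have notA : ∀ x ∈ F, ¬ S ⊆ x → ¬ A ⊆ x := fun x _ h k => h (hSA.trans k)
  have notC : ∀ x ∈ F, ¬ x ⊆ S → ¬ x ⊆ C := fun x _ h k => h (k.trans hCS)
  obtain ⟨a, b, c, d, ha, hb, hc, hd, ⟨h1, g1⟩, ⟨h2, g2⟩, ⟨h3, g3⟩, ⟨h4, h5⟩, ⟨h6, h7⟩, ⟨h8, h9⟩⟩ :=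
    hSat S hSF
  have sub : ∀ y, y ∈ insert S F → y ≠ S → y ∈ F := fun y h k =>
    (Finset.mem_insert.1 h).resolve_left k
  have rf : ∀ y : Finset (Fin n), y ⊆ y := fun y => Finset.Subset.refl y
  by_cases ea : a = S
  · subst ea
    replace hb := sub b hb (fun k => h4 (k ▸ rf _))
    replace hc := sub c hc (fun k => g1 (k ▸ rf _))
    replace hd := sub d hd (fun k => g2 (k ▸ rf _))
    exact aux_N hN hA hb hc hd (dn _ h1) (dn _ h2) h3 (notA _ hb h4) (key b hb h5 h4).1.1
      h6 h7 h8 h9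
  replace ha := sub a ha ea
  by_cases eb : b = S
  · subst eb
    replace hc := sub c hc (fun k => h6 (k ▸ rf _))
    replace hd := sub d hd (fun k => g3 (k ▸ rf _))
    exact aux_N hN ha hA hc hd h1 h2 (dn _ h3) (key a ha h4 h5).1.1 (notA _ ha h5)
      (key c hc h6 h7).1.1 (notA _ hc h7) h8 h9
  replace hb := sub b hb eb
  by_cases ec : c = S
  · subst ec
    replace hd := sub d hd (fun k => h8 (k ▸ rf _))
    exact aux_N hN ha hb hC hd (up _ h1) h2 h3 h4 h5 (key b hb h7 h6).2.1 (notC _ hb h7)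
      (key d hd h9 h8).2.1 (notC _ hd h9)
  replace hc := sub c hc ec
  by_cases ed : d = S
  · subst ed
    exact aux_N hN ha hb hc hC h1 (up _ h2) (up _ h3) h4 h5 h6 h7 (notC _ hc h8)
      (key c hc h8 h9).2.1
  exact aux_N hN ha hb hc (sub d hd ed) h1 h2 h3 h4 h5 h6 h7 h8 h9
end

section
/- Let ℱ be an 𝒩-saturated family of subsets of [n], let A' ∉ ℱ and A ∈ ℱ with A' ⊂ A, and suppose there exist three members of ℱ forming with A' an induced copy of 𝒩 in which A' is a maximal element. Then there exist X, Y, Z ∈ ℱ forming with A' an induced copy of 𝒩 in which A' is a maximal element, X is the other maximal element, and X ⊆ A. -/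
variable {n : ℕ}

/-- suppose `A' ∉ F`, `A ∈ F`, `A' ⊂ A`, and `A'` is a maximal element of
some induced copy of `𝒩` formed with three members of `F`.  Then there is such a copy
`X, Y, Z ∈ F` in which `A'` is a maximal element, `X` is the other maximal element, and
`X ⊆ A`. -/
theorem stmt13 (n : ℕ) (F : Finset (Finset (Fin n))) (hF : NSaturated F)
    (A' A : Finset (Fin n)) (hA' : A' ∉ F) (hA : A ∈ F) (hsub : A' ⊂ A)
    (h : ∃ P Q R, P ∈ F ∧ Q ∈ F ∧ R ∈ F ∧
      (IsNCopy A' P Q R ∨ IsNCopy P A' Q R)) :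
    ∃ X Y Z, X ∈ F ∧ Y ∈ F ∧ Z ∈ F ∧
      (IsNCopy A' X Y Z ∨ IsNCopy X A' Y Z) ∧ X ⊆ A := by 
  obtain ⟨hfree, hsat⟩ := hF
  have hN : ∀ A B C D, A ∈ F → B ∈ F → C ∈ F → D ∈ F → C ⊆ A → D ⊆ A → D ⊆ B →
      ¬ A ⊆ B → ¬ B ⊆ A → ¬ C ⊆ B → ¬ B ⊆ C → ¬ C ⊆ D → ¬ D ⊆ C → False := by
    intro A B C D hA hB hC hD h1 h2 h3 h4 h5 h6 h7 h8 h9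
    refine hfree ⟨A, B, C, D, hA, hB, hC, hD, ⟨h1, fun h => h9 (h2.trans h)⟩,
      ⟨h2, fun h => h8 (h1.trans h)⟩, ⟨h3, fun h => h5 (h.trans h2)⟩, ⟨h4, h5⟩, ⟨h6, h7⟩, h8, h9⟩
  obtain ⟨P, Q, R, hP, hQ, hR, h | h⟩ := h
  · refine ⟨P, Q, R, hP, hQ, hR, Or.inl h, ?_⟩
    obtain ⟨h1, h2, h3, ⟨h4, h5⟩, ⟨h6, h7⟩, h8, h9⟩ := h
    by_contra hc
    exact hN A P Q R hA hP hQ hR (h1.1.trans hsub.1) (h2.1.trans hsub.1) h3.1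
      (fun h => h6 ((h1.1.trans hsub.1).trans h)) hc h6 h7 h8 h9
  · by_cases hPA : P ⊆ A
    · exact ⟨P, Q, R, hP, hQ, hR, Or.inr h, hPA⟩
    obtain ⟨h1, h2, h3, ⟨h4, h5⟩, ⟨h6, h7⟩, h8, h9⟩ := h
    have hRA : R ⊆ A := h3.1.trans hsub.1
    have hQA : Q ⊆ A := by
      by_contra hc
      exact hN P A Q R hP hA hQ hR h1.1 h2.1 hRA hPA (fun h => h5 (hsub.1.trans h)) hc
        (fun h => h7 (hsub.1.trans h)) h8 h9
    obtain ⟨S, hS1, hS2⟩ : ∃ S : Finset (Fin n), (∀ G ∈ F, Q ⊆ G → R ⊆ G → S ⊆ G) ∧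
        (∀ T : Finset (Fin n), (∀ G ∈ F, Q ⊆ G → R ⊆ G → T ⊆ G) → T ⊆ S) := by
      classical
      refine ⟨Finset.univ.filter (fun x => ∀ G ∈ F, Q ⊆ G → R ⊆ G → x ∈ G), ?_, ?_⟩
      · intro G hG hq hr x hx
        exact (Finset.mem_filter.1 hx).2 G hG hq hr
      · intro T hT x hx
        exact Finset.mem_filter.2 ⟨Finset.mem_univ _, fun G hG hq hr => hT G hG hq hr hx⟩
    have hQS : Q ⊆ S := hS2 Q fun _ _ h _ => h
    have hRS : R ⊆ S := hS2 R fun _ _ _ h => h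
    have hSA : S ⊆ A := hS1 A hA hQA hRA
    have hSP : S ⊆ P := hS1 P hP h1.1 h2.1
    by_cases hSF : S ∈ F
    · refine ⟨S, Q, R, hSF, hQ, hR, Or.inr ⟨⟨hQS, fun h => h9 (hRS.trans h)⟩,
        ⟨hRS, fun h => h8 (hQS.trans h)⟩, h3, ⟨fun h => h6 (hQS.trans h),
        fun h => h5 (h.trans hSP)⟩, ⟨h6, h7⟩, h8, h9⟩, hSA⟩
    exfalso
    obtain ⟨A1, B, C, D, mA, mB, mC, mD, k1, k2, k3, ⟨k4, k5⟩, ⟨k6, k7⟩, k8, k9⟩ := hsat S hSF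
    replace k1 := k1.1
    replace k2 := k2.1
    replace k3 := k3.1
    have mem : ∀ T, T ∈ insert S F → T ≠ S → T ∈ F := fun T h hne =>
      (Finset.mem_insert.1 h).resolve_left hne
    by_cases eA : A1 = S
    · subst eA
      replace mB := mem B mB (fun h => k4 h.ge)
      replace mC := mem C mC (fun h => k9 (k2.trans h.ge))
      replace mD := mem D mD (fun h => k8 (k1.trans h.ge))
      apply k5
      apply hS2
      intro G hG hq hr
      have hG1 := hS1 G hG hq hr
      by_contra hc
      exact hN G B C D hG mB mC mD (k1.trans hG1) (k2.trans hG1) k3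
        (fun h => k6 ((k1.trans hG1).trans h)) hc k6 k7 k8 k9
    replace mA := mem A1 mA eA
    by_cases eB : B = S
    · subst eB
      replace mC := mem C mC (fun h => k6 h.le)
      replace mD := mem D mD (fun h => k5 (h.ge.trans k2))
      apply k6
      apply hS2
      intro G hG hq hr
      have hG1 := hS1 G hG hq hr
      by_contra hc
      exact hN A1 G C D mA hG mC mD k1 k2 (k3.trans hG1) (fun h => hc (k1.trans h))
        (fun h => k5 (hG1.trans h)) hc (fun h => k7 (hG1.trans h)) k8 k9
    replace mB := mem B mB eB
    by_cases eC : C = S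
    · subst eC
      replace mD := mem D mD (fun h => k8 h.ge)
      apply k6
      have key : ∀ T ∈ F, T ⊆ C → T ⊆ B := by
        intro T hT hTC
        by_contra hc
        exact hN A1 B T D mA mB hT mD (hTC.trans k1) k2 k3 k4 k5 hc (fun h => k7 (h.trans hTC))
          (fun h => hc (h.trans k3)) (fun h => k9 (h.trans hTC))
      exact hS1 B mB (key Q hQ hQS) (key R hR hRS)
    replace mC := mem C mC eC
    by_cases eD : D = S
    · subst eD
      apply k9
      have key : ∀ T ∈ F, T ⊆ D → T ⊆ C := by
        intro T hT hTD
        by_contra hc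
        exact hN A1 B C T mA mB mC hT k1 (hTD.trans k2) (hTD.trans k3) k4 k5 k6 k7
          (fun h => k8 (h.trans hTD)) hc
      exact hS1 C mC (key Q hQ hQS) (key R hR hRS)
    replace mD := mem D mD eD
    exact hN A1 B C D mA mB mC mD k1 k2 k3 k4 k5 k6 k7 k8 k9
end

section
/- Let ℱ be an 𝒩-saturated family of subsets of [n], let B' ∉ ℱ and B ∈ ℱ with B ⊂ B', and suppose there exist three members of ℱ forming with B' an induced copy of 𝒩 in which B' is a minimal element. Then there exist X, Y, Z ∈ ℱ forming with B' an induced copy of 𝒩 in which B' is a minimal element, Y is the other minimal element, and B ⊆ Y. -/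
variable {n : ℕ}

lemma closure_mem {n : ℕ} (F : Finset (Finset (Fin n))) (hF : NSaturated F)
    (B R S : Finset (Fin n)) (hB : B ∈ F) (hR : R ∈ F) (hBS : B ⊆ S) (hRS : R ⊆ S)
    (hup : ∀ X ∈ F, B ⊆ X → R ⊆ X → S ⊆ X)
    (hlow : ∀ T : Finset (Fin n), (∀ X ∈ F, S ⊆ X → T ⊆ X) → T ⊆ S) : S ∈ F := by
  by_contra hS
  obtain ⟨hN, hsat⟩ := hF
  obtain ⟨A, Q, C, D, hA, hQ, hC, hD, hcop⟩ := hsat S hS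
  obtain ⟨hCA, hDA, hDQ, hAQ, hCQ, hCD⟩ := hcop
  have dAQ : A ≠ Q := fun h => hAQ.1 h.le
  have dCQ : C ≠ Q := fun h => hCQ.1 h.le
  have dCD : C ≠ D := fun h => hCD.1 h.le
  have dCA := hCA.ne
  have dDA := hDA.ne
  have dDQ := hDQ.ne
  rw [Finset.mem_insert] at hA hQ hC hD
  by_cases eA : A = S
  · subst eA
    replace hQ := hQ.resolve_left dAQ.symm
    replace hC := hC.resolve_left dCA
    replace hD := hD.resolve_left dDA
    apply hAQ.2
    apply hlow
    intro X hX hSX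
    by_contra hQX
    exact hN ⟨X, Q, C, D, hX, hQ, hC, hD, hCA.trans_subset hSX, hDA.trans_subset hSX, hDQ,
      ⟨fun h => hAQ.1 (hSX.trans h), hQX⟩, hCQ, hCD⟩
  replace hA := hA.resolve_left eA
  by_cases eQ : Q = S
  · subst eQ
    replace hC := hC.resolve_left dCQ
    replace hD := hD.resolve_left dDQ
    apply hCQ.1
    apply hlow
    intro X hX hSX
    by_contra hCX
    exact hN ⟨A, X, C, D, hA, hX, hC, hD, hCA, hDA, hDQ.trans_subset hSX,
      ⟨fun h => hCX (hCA.subset.trans h), fun h => hAQ.2 (hSX.trans h)⟩,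
      ⟨hCX, fun h => hCQ.2 (hSX.trans h)⟩, hCD⟩
  replace hQ := hQ.resolve_left eQ
  by_cases eC : C = S
  · subst eC
    replace hD := hD.resolve_left dCD.symm
    have key : ∀ Y ∈ F, Y ⊆ C → Y ⊆ Q := by
      intro Y hY hYS
      by_contra hYQ
      exact hN ⟨A, Q, Y, D, hA, hQ, hY, hD, LE.le.trans_ssubset hYS hCA, hDA, hDQ, hAQ,
        ⟨hYQ, fun h => hCQ.2 (h.trans hYS)⟩,
        ⟨fun h => hYQ (h.trans hDQ.subset), fun h => hCD.2 (h.trans hYS)⟩⟩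
    exact hCQ.1 (hup Q hQ (key B hB hBS) (key R hR hRS))
  replace hC := hC.resolve_left eC
  by_cases eD : D = S
  · subst eD
    have key : ∀ Y ∈ F, Y ⊆ D → Y ⊆ C := by
      intro Y hY hYS
      by_contra hYC
      exact hN ⟨A, Q, C, Y, hA, hQ, hC, hY, hCA, LE.le.trans_ssubset hYS hDA,
        LE.le.trans_ssubset hYS hDQ, hAQ, hCQ,
        ⟨fun h => hCD.1 (h.trans hYS), hYC⟩⟩
    exact hCD.2 (hup C hC (key B hB hBS) (key R hR hRS))
  replace hD := hD.resolve_left eD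
  exact hN ⟨A, Q, C, D, hA, hQ, hC, hD, hCA, hDA, hDQ, hAQ, hCQ, hCD⟩

/-- suppose `B' ∉ F`, `B ∈ F`, `B ⊂ B'`, and `B'` is a minimal element of
some induced copy of `𝒩` formed with three members of `F`.  Then there is such a copy
`X, Y, Z ∈ F` in which `B'` is a minimal element, `Y` is the other minimal element, and
`B ⊆ Y`. -/
theorem stmt14 (n : ℕ) (F : Finset (Finset (Fin n))) (hF : NSaturated F)
    (B' B : Finset (Fin n)) (hB' : B' ∉ F) (hB : B ∈ F) (hsub : B ⊂ B')
    (h : ∃ P Q R, P ∈ F ∧ Q ∈ F ∧ R ∈ F ∧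
      (IsNCopy P Q B' R ∨ IsNCopy P Q R B')) :
    ∃ X Y Z, X ∈ F ∧ Y ∈ F ∧ Z ∈ F ∧
      (IsNCopy X Z B' Y ∨ IsNCopy X Z Y B') ∧ B ⊆ Y := by
  obtain ⟨P, Q, R, hP, hQ, hR, h | h⟩ := h
  · obtain ⟨hCA, hDA, hDQ, hAQ, hCQ, hCD⟩ := h
    have hRB : ¬ R ⊆ B := fun h => hCD.2 (h.trans hsub.subset)
    by_cases hBR : B ⊆ R
    · exact ⟨P, R, Q, hP, hR, hQ, Or.inl ⟨hCA, hDA, hDQ, hAQ, hCQ, hCD⟩, hBR⟩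
    have hBQ : B ⊆ Q := by
      by_contra hBQ
      exact hF.1 ⟨P, Q, B, R, hP, hQ, hB, hR, hsub.trans hCA, hDA, hDQ, hAQ,
        ⟨hBQ, fun h => hCQ.2 (h.trans hsub.subset)⟩, ⟨hBR, hRB⟩⟩
    have hBP : B ⊆ P := (hsub.trans hCA).subset
    obtain ⟨S, hS⟩ : ∃ S : Finset (Fin n), ∀ x, x ∈ S ↔ ∀ X ∈ F, B ⊆ X → R ⊆ X → x ∈ X := by
      classical
      exact ⟨Finset.univ.filter (fun x => ∀ X ∈ F, B ⊆ X → R ⊆ X → x ∈ X), by simp⟩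
    have hBS : B ⊆ S := fun x hx => (hS x).2 fun X _ h1 _ => h1 hx
    have hRS : R ⊆ S := fun x hx => (hS x).2 fun X _ _ h2 => h2 hx
    have hup : ∀ X ∈ F, B ⊆ X → R ⊆ X → S ⊆ X := fun X hX h1 h2 x hx => (hS x).1 hx X hX h1 h2
    have hSF : S ∈ F := closure_mem F hF B R S hB hR hBS hRS hup
      fun T hT x hx => (hS x).2 fun X hX h1 h2 => hT X hX (hup X hX h1 h2) hx
    have hSP := hup P hP hBP hDA.subset
    have hSQ := hup Q hQ hBQ hDQ.subset
    exact ⟨P, S, Q, hP, hSF, hQ, Or.inl ⟨hCA, ⟨hSP, fun h => hAQ.1 (h.trans hSQ)⟩,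
      ⟨hSQ, fun h => hAQ.2 (h.trans hSP)⟩, hAQ, hCQ,
      ⟨fun h => hCQ.1 (h.trans hSQ), fun h => hCD.2 (hRS.trans h)⟩⟩, hBS⟩
  · refine ⟨P, R, Q, hP, hR, hQ, Or.inr h, ?_⟩
    obtain ⟨hCA, hDA, hDQ, hAQ, hCQ, hCD⟩ := h
    by_contra hBR
    exact hF.1 ⟨P, Q, R, B, hP, hQ, hR, hB, hCA, hsub.trans hDA, hsub.trans hDQ, hAQ, hCQ,
      ⟨fun h => hCD.1 (h.trans hsub.subset), hBR⟩⟩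
end
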